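/- arXiv:2209.03604 — 5 statements merged into one kernel-verified Lean document; each statement's English description precedes it below -/
import Mathlib

section
/- Generalized skew-symmetry of the DG operator with generalized fluxes (Lemma 2.1): for every real number θ, every constant symmetric m × m real matrix D, and all ℝ^m-valued piecewise polynomials p and q of degree ≤ k on the periodic partition, one has H^θ(D p, q) + H^{1−θ}(D q, p) = 0. -/
open Polynomial

/-- Weighted average `p^{(θ)}` (componentwise) of a vector-valued piecewise polynomial `p`
at the node to the right of cell `j`, with periodic indexing: the left trace comes from
cell `j` evaluated at `x_{j+1/2}`, the right trace from cell `j+1` (cyclically) evaluated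
at its own left node (so that at the wrap-around node `x_{1/2} ≡ x_{N+1/2}` the right
trace is taken at `x_{1/2}`). -/
noncomputable def avgV {N m : ℕ} [NeZero N] (x : Fin (N + 1) → ℝ) (θ : ℝ)
    (p : Fin N → Fin m → Polynomial ℝ) (j : Fin N) (i : Fin m) : ℝ :=
  θ * (p j i).eval (x j.succ) + (1 - θ) * (p (j + 1) i).eval (x (j + 1).castSucc)

/-- The DG spatial operator
`H^θ(p, q) = Σ_j ( ∫_{I_j} q_j′ · p_j dx − q_j(x_{j+1/2}) · p^{(θ)}_{j+1/2}
  + q_j(x_{j−1/2}) · p^{(θ)}_{j−1/2} )` with periodic indexing. -/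
noncomputable def DGop {N m : ℕ} [NeZero N] (x : Fin (N + 1) → ℝ) (θ : ℝ)
    (p q : Fin N → Fin m → Polynomial ℝ) : ℝ :=
  ∑ j : Fin N,
    ((∫ t in (x j.castSucc)..(x j.succ),
        ∑ i : Fin m, (Polynomial.derivative (q j i)).eval t * (p j i).eval t)
      - ∑ i : Fin m, (q j i).eval (x j.succ) * avgV x θ p j i
      + ∑ i : Fin m, (q j i).eval (x j.castSucc) * avgV x θ p (j - 1) i)

/-- The bilinear form `u · D v`. -/
noncomputable def bilD {m : ℕ} (D : Matrix (Fin m) (Fin m) ℝ) (u v : Fin m → ℝ) : ℝ :=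
  ∑ i, u i * ∑ l, D i l * v l

lemma bilD_comm {m : ℕ} (D : Matrix (Fin m) (Fin m) ℝ) (hD : D.IsSymm) (u v : Fin m → ℝ) :
    bilD D u v = bilD D v u := by
  unfold bilD
  simp only [Finset.mul_sum]
  rw [Finset.sum_comm]
  refine Finset.sum_congr rfl fun i _ => Finset.sum_congr rfl fun l _ => ?_
  rw [hD.apply i l]
  ring

lemma DGop_eq {N m : ℕ} [NeZero N] (x : Fin (N + 1) → ℝ) (θ : ℝ)
    (D : Matrix (Fin m) (Fin m) ℝ) (p q : Fin N → Fin m → Polynomial ℝ) :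
    DGop x θ (fun j i => ∑ l, Polynomial.C (D i l) * p j l) q =
    ∑ j : Fin N,
      ((∫ t in (x j.castSucc)..(x j.succ),
        bilD D (fun i => (Polynomial.derivative (q j i)).eval t) (fun i => (p j i).eval t))
      - (θ * bilD D (fun i => (q j i).eval (x j.succ)) (fun i => (p j i).eval (x j.succ))
        + (1 - θ) * bilD D (fun i => (q j i).eval (x j.succ))
            (fun i => (p (j + 1) i).eval (x (j + 1).castSucc)))
      + (θ * bilD D (fun i => (q j i).eval (x j.castSucc))
            (fun i => (p (j - 1) i).eval (x (j - 1).succ))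
        + (1 - θ) * bilD D (fun i => (q j i).eval (x j.castSucc))
            (fun i => (p j i).eval (x j.castSucc)))) := by
  unfold DGop avgV bilD
  refine Finset.sum_congr rfl fun j _ => ?_
  simp only [Polynomial.eval_finset_sum, Polynomial.eval_mul, Polynomial.eval_C,
    sub_add_cancel]
  congr 1
  · congr 1
    rw [Finset.mul_sum, Finset.mul_sum, ← Finset.sum_add_distrib]
    refine Finset.sum_congr rfl fun i _ => ?_
    ring
  · rw [Finset.mul_sum, Finset.mul_sum, ← Finset.sum_add_distrib]
    refine Finset.sum_congr rfl fun i _ => ?_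
    ring

lemma bilD_integral {m : ℕ} (D : Matrix (Fin m) (Fin m) ℝ) (hD : D.IsSymm)
    (p q : Fin m → Polynomial ℝ) (a b : ℝ) :
    (∫ t in a..b, bilD D (fun i => (Polynomial.derivative (q i)).eval t) (fun i => (p i).eval t))
    + (∫ t in a..b, bilD D (fun i => (Polynomial.derivative (p i)).eval t)
        (fun i => (q i).eval t))
    = bilD D (fun i => (q i).eval b) (fun i => (p i).eval b)
      - bilD D (fun i => (q i).eval a) (fun i => (p i).eval a) := by
  have hc : ∀ u v : Fin m → Polynomial ℝ,
      Continuous fun t : ℝ => bilD D (fun i => (u i).eval t) (fun i => (v i).eval t) := by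
    intro u v
    unfold bilD
    fun_prop
  rw [← intervalIntegral.integral_add ((hc _ _).intervalIntegrable _ _)
    ((hc _ _).intervalIntegrable _ _)]
  refine intervalIntegral.integral_eq_sub_of_hasDerivAt
    (f := fun t => bilD D (fun i => (q i).eval t) (fun i => (p i).eval t)) ?_
    (((hc _ _).add (hc _ _)).intervalIntegrable _ _)
  intro t _
  rw [bilD_comm D hD (fun i => (Polynomial.derivative (p i)).eval t)]
  unfold bilD
  rw [← Finset.sum_add_distrib]
  refine HasDerivAt.fun_sum fun i _ => ?_
  exact ((q i).hasDerivAt t).mul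
    (HasDerivAt.fun_sum fun l _ => ((p l).hasDerivAt t).const_mul (D i l))

/-- generalized skew-symmetry of the DG operator:
`H^θ(D p, q) + H^{1−θ}(D q, p) = 0` for every real `θ`, every constant symmetric
`m × m` real matrix `D`, and all `ℝ^m`-valued piecewise polynomials `p, q` of
degree `≤ k` on the periodic partition of `(0, 2π)`. -/
theorem statement0 {N m k : ℕ} [NeZero N] (hk : 1 ≤ k)
    (x : Fin (N + 1) → ℝ) (hx0 : x 0 = 0) (hxN : x (Fin.last N) = 2 * Real.pi)
    (hmono : StrictMono x) (θ : ℝ)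
    (D : Matrix (Fin m) (Fin m) ℝ) (hD : D.IsSymm)
    (p q : Fin N → Fin m → Polynomial ℝ)
    (hp : ∀ j i, (p j i).natDegree ≤ k) (hq : ∀ j i, (q j i).natDegree ≤ k) :
    DGop x θ (fun j i => ∑ l, Polynomial.C (D i l) * p j l) q
      + DGop x (1 - θ) (fun j i => ∑ l, Polynomial.C (D i l) * q j l) p = 0 := by
  rw [DGop_eq, DGop_eq]
  have h1 : ∑ j : Fin N, bilD D (fun i => (q j i).eval (x j.castSucc))
        (fun i => (p (j - 1) i).eval (x (j - 1).succ))
      = ∑ j : Fin N, bilD D (fun i => (p j i).eval (x j.succ))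
        (fun i => (q (j + 1) i).eval (x (j + 1).castSucc)) := by
    rw [← Equiv.sum_comp (Equiv.addRight (1 : Fin N))]
    refine Finset.sum_congr rfl fun j _ => ?_
    simp only [Equiv.coe_addRight, add_sub_cancel_right]
    exact bilD_comm D hD _ _
  have h2 : ∑ j : Fin N, bilD D (fun i => (p j i).eval (x j.castSucc))
        (fun i => (q (j - 1) i).eval (x (j - 1).succ))
      = ∑ j : Fin N, bilD D (fun i => (q j i).eval (x j.succ))
        (fun i => (p (j + 1) i).eval (x (j + 1).castSucc)) := by
    rw [← Equiv.sum_comp (Equiv.addRight (1 : Fin N))]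
    refine Finset.sum_congr rfl fun j _ => ?_
    simp only [Equiv.coe_addRight, add_sub_cancel_right]
    exact bilD_comm D hD _ _
  have h3 := Finset.sum_congr (rfl : (Finset.univ : Finset (Fin N)) = Finset.univ)
    fun j _ => bilD_integral D hD (p j) (q j) (x j.castSucc) (x j.succ)
  have h4 : ∀ j : Fin N, ∀ y : ℝ, bilD D (fun i => (p j i).eval y) (fun i => (q j i).eval y)
      = bilD D (fun i => (q j i).eval y) (fun i => (p j i).eval y) :=
    fun j y => bilD_comm D hD _ _
  simp only [h4, Finset.sum_add_distrib, Finset.sum_sub_distrib, ← Finset.mul_sum] at h3 ⊢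
  rw [h1, h2]
  linear_combination h3
end

section
/- Absolute row- and column-sum bounds for B⁻¹ (proof of Lemma 3.1): for every real θ > 1/2 and all integers k ≥ 0 and N ≥ 2, with q = −(1 − θ)/(θ(−1)^k) one has |q| = |1 − θ|/θ < 1, and for every row index i and every column index j of B⁻¹, Σ_j |(B⁻¹)_{ij}| ≤ 1/(θ(1 − |q|)) and Σ_i |(B⁻¹)_{ij}| ≤ 1/(θ(1 − |q|)); in particular the maximum-absolute-row-sum norm ‖B⁻¹‖_∞ and the maximum-absolute-column-sum norm ‖B⁻¹‖_1 are both at most 1/(θ(1 − |q|)). -/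
/-- The circulant matrix generated by a vector `v`: its `(i, j)` entry is
`v ((j − i) mod N)`, so its first row is `(v 0, v 1, …, v (N−1))` and each
subsequent row is the cyclic right shift of the previous one. -/
def circ {N : ℕ} (v : ZMod N → ℝ) : Matrix (ZMod N) (ZMod N) ℝ :=
  Matrix.of fun i j => v (j - i)

/-- The circulant matrix `B = circ(θ(−1)^k, 0, …, 0, 1 − θ)`: first entry
`θ(−1)^k`, last entry `1 − θ`, remaining entries zero. -/
noncomputable def Bmat (N k : ℕ) (θ : ℝ) : Matrix (ZMod N) (ZMod N) ℝ :=
  circ (fun t => if t = 0 then θ * (-1) ^ k else if t = -1 then 1 - θ else 0)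

lemma Bmat_apply (N k : ℕ) (θ : ℝ) (hN : 2 ≤ N) (i j : ZMod N) :
    Bmat N k θ i j = (if j = i then θ * (-1) ^ k else 0) + (if j = i - 1 then 1 - θ else 0) := by
  have : Fact (1 < N) := ⟨hN⟩
  have h1 : (1 : ZMod N) ≠ 0 := one_ne_zero
  have e1 : (j - i = 0) ↔ (j = i) := sub_eq_zero
  have e2 : (j - i = -1) ↔ (j = i - 1) := by
    constructor
    · intro h
      linear_combination h
    · intro h
      linear_combination h
  simp only [Bmat, circ, Matrix.of_apply, e1, e2]
  by_cases h : j = i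
  · have h2 : j ≠ i - 1 := by
      intro h3
      apply h1
      linear_combination h3 - h
    rw [if_pos h, if_pos h, if_neg h2, add_zero]
  · rw [if_neg h, if_neg h, zero_add]

/-- If `a x + b (x ∘ e) = δ`, then the absolute sum of `x` is at most `1 / (|a| - |b|)`. -/
lemma abs_sum_bound {ι : Type*} [Fintype ι] [DecidableEq ι] (e : ι ≃ ι) (x : ι → ℝ) (a b : ℝ)
    (hab : |b| < |a|) (i₀ : ι) (h : ∀ i, a * x i + b * x (e i) = if i = i₀ then 1 else 0) :
    ∑ i, |x i| ≤ 1 / (|a| - |b|) := by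
  rw [le_div_iff₀ (by linarith)]
  have h1 : ∀ i, |a| * |x i| ≤ (if i = i₀ then 1 else 0) + |b| * |x (e i)| := by
    intro i
    rw [← abs_mul, ← abs_mul]
    have h2 : a * x i = (if i = i₀ then 1 else 0) - b * x (e i) := by rw [← h i]; ring
    rw [h2]
    refine (abs_sub _ _).trans ?_
    split_ifs <;> simp
  have h3 := Finset.sum_le_sum (s := Finset.univ) (fun i _ => h1 i)
  rw [Finset.sum_add_distrib, ← Finset.mul_sum, ← Finset.mul_sum,
    Equiv.sum_comp e (fun i => |x i|)] at h3
  simp at h3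
  linarith

theorem statement8 (N k : ℕ) [NeZero N] (hN : 2 ≤ N) (θ : ℝ) (hθ : 1 / 2 < θ) :
    |(-(1 - θ) / (θ * (-1) ^ k))| = |1 - θ| / θ
      ∧ |(-(1 - θ) / (θ * (-1) ^ k))| < 1
      ∧ (∀ i : ZMod N, ∑ j : ZMod N, |(Bmat N k θ)⁻¹ i j|
            ≤ 1 / (θ * (1 - |(-(1 - θ) / (θ * (-1) ^ k))|)))
      ∧ (∀ j : ZMod N, ∑ i : ZMod N, |(Bmat N k θ)⁻¹ i j|
            ≤ 1 / (θ * (1 - |(-(1 - θ) / (θ * (-1) ^ k))|))) := by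
  have hθ0 : 0 < θ := by linarith
  have hc : |θ * (-1) ^ k| = θ := by
    rw [abs_mul, abs_pow, abs_neg, abs_one, one_pow, mul_one, abs_of_pos hθ0]
  have hq : |(-(1 - θ) / (θ * (-1) ^ k))| = |1 - θ| / θ := by
    rw [abs_div, abs_neg, hc]
  have hlt : |1 - θ| < θ := by
    rw [abs_lt]
    constructor <;> linarith
  have hbd : 1 / (θ * (1 - |1 - θ| / θ)) = 1 / (|θ * (-1) ^ k| - |1 - θ|) := by
    rw [hc, mul_sub, mul_one, mul_div_cancel₀ _ hθ0.ne']
  have hlt' : |1 - θ| < |θ * (-1) ^ k| := by rw [hc]; exact hlt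
  rw [hq, hbd]
  refine ⟨rfl, (div_lt_one hθ0).2 hlt, ?_⟩
  by_cases hu : IsUnit (Bmat N k θ).det
  · constructor
    · intro i
      refine abs_sum_bound (Equiv.addRight (1 : ZMod N)) _ _ _ hlt' i ?_
      intro j
      have h := congrFun (congrFun (Matrix.nonsing_inv_mul _ hu) i) j
      have e : ∀ l : ZMod N, (j = l - 1) ↔ (l = j + 1) := by
        intro l
        rw [eq_sub_iff_add_eq, eq_comm]
      simp only [Matrix.mul_apply, Bmat_apply N k θ hN, mul_add, Finset.sum_add_distrib, e,
        Matrix.one_apply, mul_ite, mul_zero, Finset.sum_ite_eq, Finset.sum_ite_eq',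
        Finset.mem_univ, if_true] at h
      rw [Equiv.coe_addRight, mul_comm, mul_comm (1 - θ), h]
      simp only [eq_comm]
    · intro j
      refine abs_sum_bound (Equiv.subRight (1 : ZMod N)) (fun i => (Bmat N k θ)⁻¹ i j) _ _ hlt' j ?_
      intro i
      have h := congrFun (congrFun (Matrix.mul_nonsing_inv _ hu) i) j
      simp only [Matrix.mul_apply, Bmat_apply N k θ hN, add_mul, Finset.sum_add_distrib,
        Matrix.one_apply, ite_mul, zero_mul, Finset.sum_ite_eq, Finset.sum_ite_eq',
        Finset.mem_univ, if_true] at h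
      exact h
  · have h0 : (0 : ℝ) ≤ 1 / (|θ * (-1) ^ k| - |1 - θ|) :=
      one_div_nonneg.2 (by linarith)
    rw [Matrix.nonsing_inv_apply_not_isUnit _ hu]
    simpa using h0
end

section
/- Spectral norm bound for B⁻¹ (proof of Lemma 3.1): for every real θ > 1/2 and all integers k ≥ 0 and N ≥ 2, with q = −(1 − θ)/(θ(−1)^k), the inverse of the circulant matrix B = circ(θ(−1)^k, 0, …, 0, 1 − θ) satisfies ‖B⁻¹ x‖₂ ≤ (1/(θ(1 − |q|))) ‖x‖₂ for every x ∈ ℝ^N, where ‖·‖₂ denotes the Euclidean norm; equivalently, the spectral (Euclidean operator) norm of B⁻¹ is at most 1/(θ(1 − |q|)) = 1/(θ − |1 − θ|). -/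
theorem Bmat_mulVec (N k : ℕ) [NeZero N] (hN : 2 ≤ N) (θ : ℝ) (y : ZMod N → ℝ) (i : ZMod N) :
    (Bmat N k θ).mulVec y i = θ * (-1) ^ k * y i + (1 - θ) * y (i - 1) := by
  haveI : Fact (1 < N) := ⟨hN⟩
  have hne : (-1 : ZMod N) ≠ 0 := neg_ne_zero.mpr one_ne_zero
  have h : ∀ j : ZMod N, Bmat N k θ i j * y j
      = (if j = i then θ * (-1) ^ k * y j else 0)
        + (if j = i - 1 then (1 - θ) * y j else 0) := by
    intro j
    have e1 : j - i = 0 ↔ j = i := sub_eq_zero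
    have e2 : j - i = -1 ↔ j = i - 1 := by
      rw [sub_eq_iff_eq_add, neg_add_eq_sub]
    have e3 : i ≠ i - 1 := by
      intro h
      exact one_ne_zero (sub_eq_self.mp h.symm)
    simp only [Bmat, circ, Matrix.of_apply, e1, e2]
    by_cases h1 : j = i
    · subst h1
      simp [e3]
    · by_cases h2 : j = i - 1 <;> simp [h1, h2]
  simp only [Matrix.mulVec, dotProduct, h, Finset.sum_add_distrib]
  simp

theorem Bmat_lower (N k : ℕ) [NeZero N] (hN : 2 ≤ N) (θ : ℝ) (hθ : 1 / 2 < θ)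
    (y : ZMod N → ℝ) :
    (θ - |1 - θ|) ^ 2 * ∑ i, (y i) ^ 2 ≤ ∑ i, ((Bmat N k θ).mulVec y i) ^ 2 := by
  have hshift : ∑ i : ZMod N, (y (i - 1)) ^ 2 = ∑ i, (y i) ^ 2 :=
    Equiv.sum_comp (Equiv.subRight (1 : ZMod N)) (fun i => (y i) ^ 2)
  have hb : 0 ≤ |1 - θ| := abs_nonneg _
  have hb2 : |1 - θ| ^ 2 = (1 - θ) ^ 2 := sq_abs _
  have key : ∀ i : ZMod N, (θ ^ 2 - θ * |1 - θ|) * (y i) ^ 2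
      + ((1 - θ) ^ 2 - θ * |1 - θ|) * (y (i - 1)) ^ 2 ≤ ((Bmat N k θ).mulVec y i) ^ 2 := by
    intro i
    rw [Bmat_mulVec N k hN]
    generalize y i = u
    generalize y (i - 1) = v
    have hp : 0 ≤ θ * |1 - θ| := mul_nonneg (by linarith) hb
    rcases neg_one_pow_eq_or ℝ k with h | h <;> rw [h] <;>
      rcases abs_cases (1 - θ) with ⟨h', _⟩ | ⟨h', _⟩ <;> rw [h'] at hp ⊢ <;>
      nlinarith [mul_nonneg hp (sq_nonneg (u + v)), mul_nonneg hp (sq_nonneg (u - v))]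
  have hs := Finset.sum_le_sum (fun i (_ : i ∈ Finset.univ) => key i)
  rw [Finset.sum_add_distrib, ← Finset.mul_sum, ← Finset.mul_sum, hshift] at hs
  calc _ = _ := by
        rw [sub_sq, hb2]
        ring
    _ ≤ _ := hs

theorem theta_pos (θ : ℝ) (hθ : 1 / 2 < θ) : 0 < θ - |1 - θ| := by
  rcases abs_cases (1 - θ) with ⟨h, _⟩ | ⟨h, _⟩ <;> rw [h] <;> linarith

theorem Bmat_isUnit (N k : ℕ) [NeZero N] (hN : 2 ≤ N) (θ : ℝ) (hθ : 1 / 2 < θ) :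
    IsUnit (Bmat N k θ) := by
  rw [← Matrix.mulVec_injective_iff_isUnit]
  intro u v huv
  have h0 : (Bmat N k θ).mulVec (u - v) = 0 := by
    rw [Matrix.mulVec_sub]
    exact sub_eq_zero.mpr huv
  have h := Bmat_lower N k hN θ hθ (u - v)
  rw [h0] at h
  have hc := pow_pos (theta_pos θ hθ) 2
  have hS : ∑ i, ((u - v) i) ^ 2 ≤ 0 := by
    by_contra hcon
    push Not at hcon
    have := mul_pos hc hcon
    simp only [Pi.zero_apply, ne_eq, OfNat.ofNat_ne_zero, not_false_eq_true, zero_pow,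
      Finset.sum_const_zero] at h
    linarith
  have hS0 := le_antisymm hS (Finset.sum_nonneg fun i _ => sq_nonneg _)
  rw [Finset.sum_eq_zero_iff_of_nonneg (fun i _ => sq_nonneg _)] at hS0
  funext i
  have := hS0 i (Finset.mem_univ i)
  exact sub_eq_zero.mp (pow_eq_zero_iff (two_ne_zero) |>.mp this)

/-- spectral norm bound for `B⁻¹`: for every real `θ > 1/2` and
integers `k ≥ 0`, `N ≥ 2`, with `q = −(1 − θ)/(θ(−1)^k)`, one has
`‖B⁻¹ x‖₂ ≤ (1/(θ(1 − |q|))) ‖x‖₂` for every `x ∈ ℝ^N` (Euclidean norms);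
moreover `1/(θ(1 − |q|)) = 1/(θ − |1 − θ|)`. -/
theorem statement9 (N k : ℕ) [NeZero N] (hN : 2 ≤ N) (θ : ℝ) (hθ : 1 / 2 < θ) :
    (∀ x : ZMod N → ℝ,
      Real.sqrt (∑ i : ZMod N, ((Bmat N k θ)⁻¹.mulVec x i) ^ 2)
        ≤ (1 / (θ * (1 - |(-(1 - θ) / (θ * (-1) ^ k))|)))
            * Real.sqrt (∑ i : ZMod N, (x i) ^ 2))
      ∧ 1 / (θ * (1 - |(-(1 - θ) / (θ * (-1) ^ k))|)) = 1 / (θ - |1 - θ|) := by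
  have hθ0 : 0 < θ := by linarith
  have hq : θ * (1 - |(-(1 - θ) / (θ * (-1) ^ k))|) = θ - |1 - θ| := by
    rw [abs_div, abs_neg, abs_mul, abs_pow, abs_neg, abs_one, one_pow, mul_one,
      abs_of_pos hθ0]
    field_simp
  rw [hq]
  refine ⟨fun x => ?_, rfl⟩
  have hc := theta_pos θ hθ
  have hU := Bmat_isUnit N k hN θ hθ
  have h := Bmat_lower N k hN θ hθ ((Bmat N k θ)⁻¹.mulVec x)
  rw [Matrix.mulVec_mulVec, Matrix.mul_nonsing_inv _ ((Matrix.isUnit_iff_isUnit_det _).mp hU),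
    Matrix.one_mulVec] at h
  have h2 := Real.sqrt_le_sqrt h
  rw [Real.sqrt_mul (sq_nonneg _), Real.sqrt_sq hc.le] at h2
  rw [one_div, ← div_eq_inv_mul, le_div_iff₀ hc, mul_comm]
  exact h2
end

section
/- Existence and uniqueness of the cellwise correction in the modified Gauss–Radau projection (well-posedness part of Lemma 3.1): let k ≥ 1 and N ≥ 2 be integers, let θ > 1/2 be real, let 0 = x_{1/2} < x_{3/2} < ⋯ < x_{N+1/2} = 2π be a partition of (0, 2π) into cells I_j = (x_{j−1/2}, x_{j+1/2}), and let c_1, …, c_N be arbitrary real numbers. Then there exists a unique family E = (E_j)_{j=1}^N of real polynomials of degree at most k such that (i) ∫_{I_j} E_j(x) v(x) dx = 0 for every real polynomial v of degree at most k − 1 and every j = 1, …, N, and (ii) (1 − θ) E_{j−1}(x_{j−1/2}) + θ E_j(x_{j−1/2}) = c_j for every j = 2, …, N, together with the periodic closure condition (1 − θ) E_N(x_{N+1/2}) + θ E_1(x_{1/2}) = c_1. -/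
open Polynomial

/-- The bilinear form given by integration over an interval. -/
noncomputable def cellForm (a b : ℝ) : ℝ[X] →ₗ[ℝ] ℝ[X] →ₗ[ℝ] ℝ :=
  LinearMap.mk₂ ℝ (fun p v => ∫ t in a..b, p.eval t * v.eval t)
    (by
      intro p q v
      rw [← intervalIntegral.integral_add]
      · simp [add_mul]
      · exact (p.continuous.mul v.continuous).intervalIntegrable _ _
      · exact (q.continuous.mul v.continuous).intervalIntegrable _ _)
    (by
      intro r p v
      simp [mul_assoc])
    (by
      intro p q v
      rw [← intervalIntegral.integral_add]
      · simp [mul_add]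
      · exact (p.continuous.mul q.continuous).intervalIntegrable _ _
      · exact (p.continuous.mul v.continuous).intervalIntegrable _ _)
    (by
      intro r p v
      simp [mul_left_comm])

lemma cellForm_apply (a b : ℝ) (p v : ℝ[X]) :
    cellForm a b p v = ∫ t in a..b, p.eval t * v.eval t := rfl

lemma sq_eval_eq {k : ℕ} (hk : 1 ≤ k) (a b : ℝ) (p : ℝ[X]) (hp : p.natDegree ≤ k)
    (h : ∀ v : ℝ[X], v.natDegree ≤ k - 1 → cellForm a b p v = 0) :
    p.eval b ^ 2 = p.eval a ^ 2 := by
  have h1 := h (derivative p) ((natDegree_derivative_le p).trans (by omega))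
  rw [cellForm_apply] at h1
  have h2 : ∫ t in a..b, 2 * (p.eval t * (derivative p).eval t) = p.eval b ^ 2 - p.eval a ^ 2 := by
    apply intervalIntegral.integral_eq_sub_of_hasDerivAt (f := fun t => p.eval t ^ 2)
    · intro t _
      have := (p.hasDerivAt t).pow 2
      refine this.congr_deriv ?_
      simp [mul_assoc]
    · exact (continuous_const.mul (p.continuous.mul (derivative p).continuous)).intervalIntegrable _ _
  rw [intervalIntegral.integral_const_mul, h1] at h2
  linarith

lemma eq_zero_of_left {k : ℕ} (hk : 1 ≤ k) (a b : ℝ) (hab : a < b) (p : ℝ[X])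
    (hp : p.natDegree ≤ k)
    (h : ∀ v : ℝ[X], v.natDegree ≤ k - 1 → cellForm a b p v = 0) (h0 : p.eval a = 0) : p = 0 := by
  obtain ⟨q, rfl⟩ := dvd_iff_isRoot.mpr h0
  by_contra hne
  have hq : q ≠ 0 := right_ne_zero_of_mul hne
  rw [natDegree_mul (X_sub_C_ne_zero a) hq, natDegree_X_sub_C] at hp
  have h1 := h q (by omega)
  rw [cellForm_apply] at h1
  obtain ⟨t, ht, htq⟩ : ∃ t ∈ Set.Ioo a b, q.eval t ≠ 0 := by
    by_contra hc
    push Not at hc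
    exact hq (eq_zero_of_infinite_isRoot q ((Set.Ioo_infinite hab).mono fun t ht => hc t ht))
  have : 0 < ∫ t in a..b, ((X - C a) * q).eval t * q.eval t := by
    apply intervalIntegral.integral_pos hab
    · exact (((X - C a) * q).continuous.mul q.continuous).continuousOn
    · intro s hs
      simp only [eval_mul, eval_sub, eval_X, eval_C, mul_assoc]
      exact mul_nonneg (by linarith [hs.1]) (mul_self_nonneg _)
    · refine ⟨t, ⟨ht.1.le, ht.2.le⟩, ?_⟩
      simp only [eval_mul, eval_sub, eval_X, eval_C, mul_assoc]
      exact mul_pos (by linarith [ht.1]) (mul_self_pos.mpr htq)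
  linarith

lemma family_eq_zero {N k : ℕ} [NeZero N] (hk : 1 ≤ k) (θ : ℝ) (hθ : 1 / 2 < θ)
    (x : Fin (N + 1) → ℝ) (hmono : StrictMono x) (E : Fin N → ℝ[X])
    (hd : ∀ j, (E j).natDegree ≤ k)
    (ho : ∀ (j : Fin N) (v : ℝ[X]), v.natDegree ≤ k - 1 →
      cellForm (x j.castSucc) (x j.succ) (E j) v = 0)
    (hc : ∀ j : Fin N, (1 - θ) * (E (j - 1)).eval (x (j - 1).succ)
          + θ * (E j).eval (x j.castSucc) = 0) : E = 0 := by
  have hs : ∀ j, θ ^ 2 * (E j).eval (x j.castSucc) ^ 2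
      = (1 - θ) ^ 2 * (E (j - 1)).eval (x (j - 1).castSucc) ^ 2 := by
    intro j
    rw [← sq_eval_eq hk _ _ _ (hd (j - 1)) (ho (j - 1)), ← mul_pow, ← mul_pow,
      eq_neg_of_add_eq_zero_left (hc j), neg_sq]
  have hsum := Finset.sum_congr (s₁ := Finset.univ) rfl (fun j _ => hs j)
  have hshift : ∑ j : Fin N, (E (j - 1)).eval (x (j - 1).castSucc) ^ 2
      = ∑ j : Fin N, (E j).eval (x j.castSucc) ^ 2 :=
    (Equiv.subRight (1 : Fin N)).sum_comp (fun j => (E j).eval (x j.castSucc) ^ 2)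
  rw [← Finset.mul_sum, ← Finset.mul_sum, hshift] at hsum
  have hz : ∑ j : Fin N, (E j).eval (x j.castSucc) ^ 2 = 0 := by
    have : (2 * θ - 1) * ∑ j : Fin N, (E j).eval (x j.castSucc) ^ 2 = 0 := by linarith
    exact (mul_eq_zero.mp this).resolve_left (by linarith)
  rw [Finset.sum_eq_zero_iff_of_nonneg (fun j _ => sq_nonneg _)] at hz
  funext j
  exact eq_zero_of_left hk _ _ (hmono Fin.castSucc_lt_succ) _ (hd j) (ho j)
    (pow_eq_zero_iff two_ne_zero |>.mp (hz j (Finset.mem_univ _)))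

/-- The full linear system. -/
noncomputable def cellSystem {N : ℕ} [NeZero N] (k : ℕ) (θ : ℝ) (x : Fin (N + 1) → ℝ) :
    (Fin N → degreeLT ℝ (k + 1)) →ₗ[ℝ] (Fin N → (Module.Dual ℝ (degreeLT ℝ k)) × ℝ) where
  toFun E j := (((cellForm (x j.castSucc) (x j.succ)) (E j : ℝ[X])).domRestrict _,
    (1 - θ) * (E (j - 1) : ℝ[X]).eval (x (j - 1).succ) + θ * (E j : ℝ[X]).eval (x j.castSucc))
  map_add' E F := by
    funext j
    refine Prod.ext ?_ ?_
    · ext v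
      simp
    · simp
      ring
  map_smul' r E := by
    funext j
    refine Prod.ext ?_ ?_
    · ext v
      simp
    · simp
      ring

lemma mem_degreeLT_iff_natDegree {k : ℕ} (hk : 1 ≤ k) (v : ℝ[X]) :
    v ∈ degreeLT ℝ k ↔ v.natDegree ≤ k - 1 := by
  rw [mem_degreeLT]
  by_cases hv : v = 0
  · simp [hv]
  · rw [← natDegree_lt_iff_degree_lt hv]
    omega

/-- existence and uniqueness of the cellwise correction in the modified
Gauss–Radau projection: for `k ≥ 1`, `N ≥ 2`, `θ > 1/2`, a partition
`0 = x_{1/2} < ⋯ < x_{N+1/2} = 2π` and arbitrary reals `c_1, …, c_N`, there is a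
unique family `E = (E_j)` of polynomials of degree at most `k` such that
(i) `∫_{I_j} E_j v = 0` for every polynomial `v` of degree at most `k − 1`, and
(ii) `(1 − θ) E_{j−1}(x_{j−1/2}) + θ E_j(x_{j−1/2}) = c_j` for `j = 2, …, N`,
together with the periodic closure `(1 − θ) E_N(x_{N+1/2}) + θ E_1(x_{1/2}) = c_1`.
(Cells are indexed by `Fin N` with cyclic arithmetic; the node between cells `j − 1`
and `j` is evaluated from the left as `x (j−1).succ` and from the right as
`x j.castSucc`, which agree except at the wrap-around node, where the left trace is
taken at `x_{N+1/2}` and the right trace at `x_{1/2}`.) -/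
theorem statement10 {N k : ℕ} [NeZero N] (hN : 2 ≤ N) (hk : 1 ≤ k)
    (θ : ℝ) (hθ : 1 / 2 < θ)
    (x : Fin (N + 1) → ℝ) (hx0 : x 0 = 0) (hxN : x (Fin.last N) = 2 * Real.pi)
    (hmono : StrictMono x) (c : Fin N → ℝ) :
    ∃! E : Fin N → Polynomial ℝ,
      (∀ j : Fin N, (E j).natDegree ≤ k) ∧
      (∀ (j : Fin N) (v : Polynomial ℝ), v.natDegree ≤ k - 1 →
        ∫ t in (x j.castSucc)..(x j.succ), (E j).eval t * v.eval t = 0) ∧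
      (∀ j : Fin N, (1 - θ) * (E (j - 1)).eval (x (j - 1).succ)
          + θ * (E j).eval (x j.castSucc) = c j) := by
  have hdual : Module.finrank ℝ (degreeLT ℝ k) = k := by
    rw [(degreeLTEquiv ℝ k).finrank_eq, Module.finrank_fin_fun]
  have hdual' : Module.finrank ℝ (degreeLT ℝ (k + 1)) = k + 1 := by
    rw [(degreeLTEquiv ℝ (k + 1)).finrank_eq, Module.finrank_fin_fun]
  have : FiniteDimensional ℝ (degreeLT ℝ k) := Module.Finite.equiv (degreeLTEquiv ℝ k).symm
  have : FiniteDimensional ℝ (degreeLT ℝ (k + 1)) :=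
    Module.Finite.equiv (degreeLTEquiv ℝ (k + 1)).symm
  have hinj : Function.Injective (cellSystem (N := N) k θ x) := by
    rw [injective_iff_map_eq_zero]
    intro E hE
    have key := family_eq_zero hk θ hθ x hmono (fun j => (E j : ℝ[X]))
      (fun j => by simpa using (mem_degreeLT_iff_natDegree (by omega) _).mp (E j).2)
      (fun j v hv => by
        have h1 := congrArg Prod.fst (congrFun hE j)
        exact LinearMap.congr_fun h1 ⟨v, (mem_degreeLT_iff_natDegree hk v).mpr hv⟩)
      (fun j => congrArg Prod.snd (congrFun hE j))
    funext j
    exact Subtype.ext (congrFun key j)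
  have hsurj : Function.Surjective (cellSystem (N := N) k θ x) := by
    refine (LinearMap.injective_iff_surjective_of_finrank_eq_finrank ?_).mp hinj
    simp [Module.finrank_pi_fintype, Module.finrank_prod, Subspace.dual_finrank_eq, hdual, hdual']
  obtain ⟨E, hE⟩ := hsurj (fun j => (0, c j))
  have hEd : ∀ j, (E j : ℝ[X]).natDegree ≤ k := fun j => by
    simpa using (mem_degreeLT_iff_natDegree (by omega) _).mp (E j).2
  have hEo : ∀ (j : Fin N) (v : ℝ[X]), v.natDegree ≤ k - 1 →
      cellForm (x j.castSucc) (x j.succ) (E j : ℝ[X]) v = 0 := fun j v hv => by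
    have h1 := congrArg Prod.fst (congrFun hE j)
    exact LinearMap.congr_fun h1 ⟨v, (mem_degreeLT_iff_natDegree hk v).mpr hv⟩
  have hEc : ∀ j : Fin N, (1 - θ) * (E (j - 1) : ℝ[X]).eval (x (j - 1).succ)
      + θ * (E j : ℝ[X]).eval (x j.castSucc) = c j :=
    fun j => congrArg Prod.snd (congrFun hE j)
  refine ⟨fun j => (E j : ℝ[X]), ⟨hEd, hEo, hEc⟩, ?_⟩
  rintro F ⟨hFd, hFo, hFc⟩
  have key := family_eq_zero hk θ hθ x hmono (fun j => F j - (E j : ℝ[X]))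
    (fun j => (natDegree_sub_le _ _).trans (max_le (hFd j) (hEd j)))
    (fun j v hv => by
      rw [map_sub, LinearMap.sub_apply, hEo j v hv, cellForm_apply, hFo j v hv, sub_zero])
    (fun j => by
      simp only [eval_sub]
      linarith [hFc j, hEc j])
  funext j
  exact sub_eq_zero.mp (congrFun key j)
end

section
/- ℓ²-stability of the cellwise correction (approximation part of Lemma 3.1, abstract form): let k ≥ 1 and N ≥ 2 be integers, let θ > 1/2 be real, let 0 = x_{1/2} < x_{3/2} < ⋯ < x_{N+1/2} = 2π be a partition of (0, 2π) into cells I_j = (x_{j−1/2}, x_{j+1/2}), let c_1, …, c_N be real numbers, and let E = (E_j)_{j=1}^N be the unique family of real polynomials of degree at most k satisfying ∫_{I_j} E_j(x) v(x) dx = 0 for every polynomial v of degree at most k − 1 and every j, together with (1 − θ) E_{j−1}(x_{j−1/2}) + θ E_j(x_{j−1/2}) = c_j for j = 2, …, N and (1 − θ) E_N(x_{N+1/2}) + θ E_1(x_{1/2}) = c_1. Then Σ_{j=1}^N ∫_{I_j} E_j(x)² dx ≤ ( h / ((2k+1) θ² (1 − |q|)²) ) Σ_{j=1}^N c_j²,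 where h = max_{1 ≤ j ≤ N} (x_{j+1/2} − x_{j−1/2}) and |q| = |1 − θ|/θ < 1. -/
open Polynomial

lemma poly_ftc (P : Polynomial ℝ) (a b : ℝ) :
    ∫ t in a..b, P.derivative.eval t = P.eval b - P.eval a :=
  intervalIntegral.integral_eq_sub_of_hasDerivAt (fun t _ => P.hasDerivAt t)
    (P.derivative.continuous.intervalIntegrable a b)

lemma cell_facts (k : ℕ) (hk : 1 ≤ k) (a b : ℝ) (P : Polynomial ℝ) (hdeg : P.natDegree ≤ k)
    (horth : ∀ v : Polynomial ℝ, v.natDegree ≤ k - 1 →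
      ∫ t in a..b, P.eval t * v.eval t = 0) :
    (P.eval b) ^ 2 = (P.eval a) ^ 2 ∧
    (2 * k + 1) * ∫ t in a..b, (P.eval t) ^ 2 = (b - a) * (P.eval a) ^ 2 := by
  have h1 : (P.eval b) ^ 2 = (P.eval a) ^ 2 := by
    have h := horth P.derivative ((natDegree_derivative_le P).trans (by omega))
    have h2 := poly_ftc (P ^ 2) a b
    have h3 : ∫ t in a..b, (derivative (P ^ 2)).eval t
        = 2 * ∫ t in a..b, P.eval t * P.derivative.eval t := by
      rw [← intervalIntegral.integral_const_mul]
      congr 1; ext t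
      simp [derivative_pow]; ring
    rw [h3, h] at h2
    simp at h2; linarith
  refine ⟨h1, ?_⟩
  have hv : ((X - C a) * P.derivative - C (k : ℝ) * P).natDegree ≤ k - 1 := by
    rw [natDegree_le_iff_coeff_eq_zero]
    intro n hn
    obtain ⟨m, rfl⟩ : ∃ m, n = m + 1 := ⟨n - 1, by omega⟩
    have e2 : P.coeff (m + 1 + 1) = 0 := coeff_eq_zero_of_natDegree_lt (by omega)
    rw [sub_mul, coeff_sub, coeff_sub, coeff_X_mul, coeff_C_mul, coeff_C_mul,
      coeff_derivative, coeff_derivative, e2]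
    by_cases hm : m + 1 = k
    · subst hm; push_cast; ring
    · have e1 : P.coeff (m + 1) = 0 := coeff_eq_zero_of_natDegree_lt (by omega)
      rw [e1]; ring
  have h := horth _ hv
  have h2 := poly_ftc ((X - C a) * P ^ 2) a b
  have h3 : ∫ t in a..b, (derivative ((X - C a) * P ^ 2)).eval t
      = (2 * k + 1) * (∫ t in a..b, (P.eval t) ^ 2) + 2 * ∫ t in a..b,
        P.eval t * ((X - C a) * P.derivative - C (k : ℝ) * P).eval t := by
    rw [← intervalIntegral.integral_const_mul, ← intervalIntegral.integral_const_mul,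
      ← intervalIntegral.integral_add]
    · congr 1; ext t
      simp [derivative_pow, derivative_mul]; ring
    · apply Continuous.intervalIntegrable; fun_prop
    · apply Continuous.intervalIntegrable; fun_prop
  rw [h3, h] at h2
  simp at h2
  rw [h2, h1]

/-- ℓ²-stability of the cellwise correction: for `k ≥ 1`, `N ≥ 2`,
`θ > 1/2`, a partition `0 = x_{1/2} < ⋯ < x_{N+1/2} = 2π`, reals `c_1, …, c_N`, and
`E = (E_j)` the family of polynomials of degree at most `k` satisfying the
orthogonality conditions and the node conditions
`(1 − θ) E_{j−1}(x_{j−1/2}) + θ E_j(x_{j−1/2}) = c_j` (with periodic closure),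
one has `Σ_j ∫_{I_j} E_j² ≤ ( h / ((2k+1) θ² (1 − |q|)²) ) Σ_j c_j²`, where
`h = max_j (x_{j+1/2} − x_{j−1/2})` and `|q| = |1 − θ|/θ < 1`. -/
theorem statement11 {N k : ℕ} [NeZero N] (hN : 2 ≤ N) (hk : 1 ≤ k)
    (θ : ℝ) (hθ : 1 / 2 < θ)
    (x : Fin (N + 1) → ℝ) (hx0 : x 0 = 0) (hxN : x (Fin.last N) = 2 * Real.pi)
    (hmono : StrictMono x) (c : Fin N → ℝ)
    (E : Fin N → Polynomial ℝ)
    (hdeg : ∀ j : Fin N, (E j).natDegree ≤ k)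
    (horth : ∀ (j : Fin N) (v : Polynomial ℝ), v.natDegree ≤ k - 1 →
      ∫ t in (x j.castSucc)..(x j.succ), (E j).eval t * v.eval t = 0)
    (hnode : ∀ j : Fin N, (1 - θ) * (E (j - 1)).eval (x (j - 1).succ)
        + θ * (E j).eval (x j.castSucc) = c j)
    (h : ℝ) (hub : ∀ j : Fin N, x j.succ - x j.castSucc ≤ h)
    (hmax : ∃ j : Fin N, x j.succ - x j.castSucc = h) :
    ∑ j : Fin N, ∫ t in (x j.castSucc)..(x j.succ), ((E j).eval t) ^ 2
      ≤ (h / ((2 * k + 1) * θ ^ 2 * (1 - |1 - θ| / θ) ^ 2)) * ∑ j : Fin N, (c j) ^ 2 := by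
  have hfacts := fun j => cell_facts k hk (x j.castSucc) (x j.succ) (E j) (hdeg j) (horth j)
  have hθ0 : 0 < θ := by linarith
  have hD : |1 - θ| < θ := by rw [abs_lt]; constructor <;> linarith
  set S := ∑ j : Fin N, ((E j).eval (x j.castSucc)) ^ 2 with hS
  have hSb : ∑ j : Fin N, ((E (j - 1)).eval (x (j - 1).succ)) ^ 2 = S := by
    rw [hS, ← Equiv.sum_comp (Equiv.subRight (1 : Fin N))
      (fun j : Fin N => ((E j).eval (x j.castSucc)) ^ 2)]
    exact Finset.sum_congr rfl fun j _ => (hfacts (j - 1)).1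
  have hstab : (θ - |1 - θ|) ^ 2 * S ≤ ∑ j : Fin N, (c j) ^ 2 := by
    have e : (θ - |1 - θ|) ^ 2 * S = ∑ j : Fin N,
        ((θ ^ 2 - θ * |1 - θ|) * ((E j).eval (x j.castSucc)) ^ 2
          + (|1 - θ| ^ 2 - θ * |1 - θ|) * ((E (j - 1)).eval (x (j - 1).succ)) ^ 2) := by
      rw [Finset.sum_add_distrib, ← Finset.mul_sum, ← Finset.mul_sum, hSb, ← hS]; ring
    rw [e]
    refine Finset.sum_le_sum fun j _ => ?_
    rw [← hnode j]
    generalize (E j).eval (x j.castSucc) = p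
    generalize (E (j - 1)).eval (x (j - 1).succ) = r
    rcases abs_cases (1 - θ) with ⟨h1, h2⟩ | ⟨h1, h2⟩
    · rw [h1]; nlinarith [mul_nonneg (mul_nonneg hθ0.le h2) (sq_nonneg (p + r))]
    · rw [h1]; nlinarith [mul_nonneg (mul_nonneg hθ0.le (by linarith : 0 ≤ -(1 - θ))) (sq_nonneg (p - r))]
  have hK : (0 : ℝ) < 2 * k + 1 := by positivity
  have hh : 0 ≤ h := by
    obtain ⟨j, hj⟩ := hmax
    have := hmono (Fin.castSucc_lt_succ (i := j))
    linarith
  have hI : (2 * (k : ℝ) + 1) * ∑ j : Fin N, ∫ t in (x j.castSucc)..(x j.succ), ((E j).eval t) ^ 2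
      ≤ h * S := by
    rw [Finset.mul_sum, hS, Finset.mul_sum]
    refine Finset.sum_le_sum fun j _ => ?_
    rw [(hfacts j).2]
    exact mul_le_mul_of_nonneg_right (hub j) (sq_nonneg _)
  have hden : (2 * (k : ℝ) + 1) * θ ^ 2 * (1 - |1 - θ| / θ) ^ 2
      = (2 * k + 1) * (θ - |1 - θ|) ^ 2 := by
    field_simp
  have hd2 : 0 < (θ - |1 - θ|) ^ 2 := pow_pos (by linarith) 2
  rw [hden, div_mul_eq_mul_div, le_div_iff₀ (by positivity)]
  nlinarith [mul_le_mul_of_nonneg_left hI hd2.le, mul_le_mul_of_nonneg_left hstab hh]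
end
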